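/- Let G be a context-free grammar in Chomsky normal form and let t be a parse tree of G. Then osc(t) − 1 ≤ dim(t) ≤ 2·osc(t). -/

import Mathlib

/-- The two-letter Dyck alphabet: `D.ab` is `ā` (the opening symbol) and `D.a` is `a`
(the closing symbol). -/
inductive D where
  | ab : D  -- ā
  | a : D   -- a
deriving DecidableEq

/-- Parse trees of the grammar `G_D = ({S}, {ā, a}, S, {S → ā S a S, S → ε})`:
`eps` is an application of `S → ε` and `node t₁ t₂` an application of `S → ā S a S`. -/
inductive DyckTree where
  | eps : DyckTree
  | node : DyckTree → DyckTree → DyckTree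

/-- The word generated by a parse tree of `G_D`. -/
def DyckTree.yield : DyckTree → List D
  | .eps => []
  | .node t₁ t₂ => D.ab :: (t₁.yield ++ D.a :: t₂.yield)

/-- The Dyck language `L_D`: the language generated by `G_D`. -/
def LD : Set (List D) := { w | ∃ t : DyckTree, t.yield = w }

/-- `Matches t i j` holds iff positions `i < j` (0-indexed) of the word `t.yield` form a
matching pair: position `i` carries `ā`, position `j` carries `a`, and the two
corresponding leaves have the same parent in the parse tree `t`. -/
inductive Matches : DyckTree → ℕ → ℕ → Prop
  | head (t₁ t₂ : DyckTree) : Matches (.node t₁ t₂) 0 (t₁.yield.length + 1)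
  | left {t₁ : DyckTree} {i j : ℕ} (t₂ : DyckTree) :
      Matches t₁ i j → Matches (.node t₁ t₂) (i + 1) (j + 1)
  | right {t₂ : DyckTree} {i j : ℕ} (t₁ : DyckTree) :
      Matches t₂ i j → Matches (.node t₁ t₂) (t₁.yield.length + 2 + i) (t₁.yield.length + 2 + j)

/-- `DelStep w v`: `v` results from `w ∈ L_D` by deleting (both positions of) one
matching pair of `w`. -/
def DelStep (w v : List D) : Prop :=
  ∃ (t : DyckTree) (i j : ℕ), t.yield = w ∧ Matches t i j ∧
    v = (w.eraseIdx j).eraseIdx i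

/-- The ordering `≼` on Dyck words: `dyckLE v w` (i.e. `v ≼ w`) holds iff `v` results
from `w` by deleting 0 or more matching pairs. -/
def dyckLE (v w : List D) : Prop := Relation.ReflTransGen DelStep w v

/-- The harmonics: `h_0 = ε` and `h_{i+1} = ā h_i a ā h_i a`. -/
def harmonicW : ℕ → List D
  | 0 => []
  | i + 1 => (D.ab :: (harmonicW i ++ [D.a])) ++ (D.ab :: (harmonicW i ++ [D.a]))

/-- `ĥ_i = ā h_i a`. -/
def hatHarmonic (i : ℕ) : List D := D.ab :: (harmonicW i ++ [D.a])

/-- The rank of a Dyck word `w`: the greatest `q` such that `h_q ≼ w`. -/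
noncomputable def rank (w : List D) : ℕ := sSup { q : ℕ | dyckLE (harmonicW q) w }

/-!
STATEMENT 5: Let `G` be a context-free grammar in Chomsky normal form and let `t` be a
parse tree of `G`. Then `osc(t) − 1 ≤ dim(t) ≤ 2·osc(t)` (the first inequality is
stated as `osc(t) ≤ dim(t) + 1` to avoid truncated subtraction on `ℕ`).
-/

/-- Parse trees of a grammar in Chomsky normal form (variables `N`, terminals `T`):
`lf X b` is a node labelled `X` whose only child is a leaf labelled `b`
(rule `X → b`), and `br X t₁ t₂` is a node labelled `X` with two children
(rule `X → Y Z` where `Y`, `Z` are the root labels of `t₁`, `t₂`). -/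
inductive CNFTree (N T : Type) where
  | lf : N → T → CNFTree N T
  | br : N → CNFTree N T → CNFTree N T → CNFTree N T

/-- The variable labelling the root. -/
def CNFTree.root {N T : Type} : CNFTree N T → N
  | .lf X _ => X
  | .br X _ _ => X

/-- `IsCNFTree R t`: `t` is a (quasi-)parse tree of the Chomsky-normal-form grammar
whose rule set is `R`, where a rule `(X, .inl (Y, Z)) ∈ R` stands for `X → Y Z` and
`(X, .inr b) ∈ R` stands for `X → b`. -/
def IsCNFTree {N T : Type} (R : Set (N × (N × N ⊕ T))) : CNFTree N T → Prop
  | .lf X b => (X, Sum.inr b) ∈ R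
  | .br X t₁ t₂ => (X, Sum.inl (t₁.root, t₂.root)) ∈ R ∧ IsCNFTree R t₁ ∧ IsCNFTree R t₂

/-- The dimension of a tree: a leaf has dimension 0; a node with children
`n₁, …, n_k` has dimension `max_i dim(n_i)` if this maximum is attained by a unique
child and `max_i dim(n_i) + 1` otherwise.  For a parse tree of a grammar in Chomsky
normal form, a node `lf X b` has the single child `b` (a leaf of dimension 0, so the
maximum is unique and the dimension is 0) and a node `br X t₁ t₂` has the two
children `t₁, t₂` (so the maximum is non-unique exactly when `dim t₁ = dim t₂`). -/
def dimC {N T : Type} : CNFTree N T → ℕ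
  | .lf _ _ => 0
  | .br _ t₁ t₂ => if dimC t₁ = dimC t₂ then dimC t₁ + 1 else max (dimC t₁) (dimC t₂)

/-- The footprint `α(n)` of a node of a CNF parse tree:
`α(n) = a` for a leaf, `α(n) = a ā^k α(n₁) … α(n_k)` for a node with `k` children.
Thus `α(lf X b) = a ā a` and `α(br X t₁ t₂) = a ā ā α(t₁) α(t₂)`. -/
def alphaC {N T : Type} : CNFTree N T → List D
  | .lf _ _ => [D.a, D.ab, D.a]
  | .br _ t₁ t₂ => D.a :: D.ab :: D.ab :: (alphaC t₁ ++ alphaC t₂)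

/-- The footprint of the tree `t` with root `n`: `α(t) = ā α(n)`. -/
def alphaTC {N T : Type} (t : CNFTree N T) : List D := D.ab :: alphaC t

/-- The oscillation of a tree: `osc(t) = rank(α(t))`. -/
noncomputable def oscC {N T : Type} (t : CNFTree N T) : ℕ := rank (alphaTC t)

namespace DyckTree

/-- Concatenation of Dyck words at the level of parse trees. -/
def append : DyckTree → DyckTree → DyckTree
  | .eps, y => y
  | .node u v, y => .node u (v.append y)

theorem yield_append (x y : DyckTree) : (x.append y).yield = x.yield ++ y.yield := by
  induction x with
  | eps => rfl
  | node u v _ ihv => simp [append, yield, ihv]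

theorem append_eps (x : DyckTree) : x.append .eps = x := by
  induction x with
  | eps => rfl
  | node u v _ ihv => simp [append, ihv]

/-- Unambiguity of `G_D`, in the presence of trailing words that do not start with `ā`. -/
theorem yield_append_cancel (t : DyckTree) : ∀ (t' : DyckTree) (u u' : List D),
    u.head? ≠ some D.ab → u'.head? ≠ some D.ab → t.yield ++ u = t'.yield ++ u' →
    t = t' ∧ u = u' := by
  induction t with
  | eps =>
    rintro (_ | ⟨x', y'⟩) u u' hu hu' h
    · exact ⟨rfl, h⟩
    · simp only [yield, List.nil_append] at h
      simp [h] at hu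
  | node x y ihx ihy =>
    rintro (_ | ⟨x', y'⟩) u u' hu hu' h
    · simp only [yield, List.nil_append] at h
      simp [← h] at hu'
    · simp only [yield, List.cons_append, List.append_assoc, List.cons.injEq, true_and] at h
      obtain ⟨rfl, hy⟩ := ihx x' _ _ (by simp) (by simp) h
      obtain ⟨rfl, hu_eq⟩ := ihy y' u u' hu hu' (List.cons.inj hy).2
      exact ⟨rfl, hu_eq⟩

theorem yield_injective : Function.Injective yield := fun t t' h =>
  (yield_append_cancel t t' [] [] (by simp) (by simp) (by simpa using h)).1

/-- Deletion of one matching pair, on parse trees. -/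
inductive Del : DyckTree → DyckTree → Prop
  | head (x y : DyckTree) : Del (.node x y) (x.append y)
  | left {x x' : DyckTree} (y : DyckTree) : Del x x' → Del (.node x y) (.node x' y)
  | right (x : DyckTree) {y y' : DyckTree} : Del y y' → Del (.node x y) (.node x y')

end DyckTree

open DyckTree

theorem Matches.lt_length {t : DyckTree} {i j : ℕ} (h : Matches t i j) :
    i < j ∧ j < t.yield.length := by
  induction h <;> simp only [yield, List.length_cons, List.length_append] at * <;> omega

theorem eraseIdx_head (x y : DyckTree) :
    (((DyckTree.node x y).yield.eraseIdx (x.yield.length + 1)).eraseIdx 0) =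
      (x.append y).yield := by
  simp [yield, yield_append, List.eraseIdx_append_of_length_le]

theorem eraseIdx_left {x x' : DyckTree} (y : DyckTree) {i j : ℕ} (h : Matches x i j)
    (hx : x'.yield = (x.yield.eraseIdx j).eraseIdx i) :
    (DyckTree.node x' y).yield =
      ((DyckTree.node x y).yield.eraseIdx (j + 1)).eraseIdx (i + 1) := by
  obtain ⟨h₁, h₂⟩ := h.lt_length
  simp only [yield, List.eraseIdx_cons_succ]
  rw [List.eraseIdx_append_of_lt_length h₂, List.eraseIdx_append_of_lt_length, hx]
  rw [List.length_eraseIdx_of_lt h₂]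
  omega

theorem eraseIdx_right (x : DyckTree) {y y' : DyckTree} {i j : ℕ}
    (hy : y'.yield = (y.yield.eraseIdx j).eraseIdx i) :
    (DyckTree.node x y').yield =
      ((DyckTree.node x y).yield.eraseIdx (x.yield.length + 2 + j)).eraseIdx
        (x.yield.length + 2 + i) := by
  have key (l : List D) (k : ℕ) :
      (D.ab :: (x.yield ++ D.a :: l)).eraseIdx (x.yield.length + 2 + k) =
        D.ab :: (x.yield ++ D.a :: l.eraseIdx k) := by
    rw [show x.yield.length + 2 + k = x.yield.length + (k + 1) + 1 by omega,
      List.eraseIdx_cons_succ, List.eraseIdx_append_of_length_le (by omega),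
      Nat.add_sub_cancel_left, List.eraseIdx_cons_succ]
  simp only [yield, key, hy]

theorem Matches.exists_del {t : DyckTree} {i j : ℕ} (h : Matches t i j) :
    ∃ t', Del t t' ∧ t'.yield = (t.yield.eraseIdx j).eraseIdx i := by
  induction h with
  | head x y => exact ⟨_, .head x y, (eraseIdx_head x y).symm⟩
  | left y h ih =>
    obtain ⟨x', hd, hx⟩ := ih
    exact ⟨_, .left y hd, eraseIdx_left y h hx⟩
  | right x h ih =>
    obtain ⟨y', hd, hy⟩ := ih
    exact ⟨_, .right x hd, eraseIdx_right x hy⟩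

namespace DyckTree

theorem Del.exists_matches {t t' : DyckTree} (h : Del t t') :
    ∃ i j, Matches t i j ∧ t'.yield = (t.yield.eraseIdx j).eraseIdx i := by
  induction h with
  | head x y => exact ⟨_, _, .head x y, (eraseIdx_head x y).symm⟩
  | left y h ih =>
    obtain ⟨i, j, hm, hx⟩ := ih
    exact ⟨_, _, .left y hm, eraseIdx_left y hm hx⟩
  | right x h ih =>
    obtain ⟨i, j, hm, hy⟩ := ih
    exact ⟨_, _, .right x hm, eraseIdx_right x hy⟩

/-- `t.Reduces t'`: the tree `t'` results from `t` by deleting matching pairs. -/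
abbrev Reduces : DyckTree → DyckTree → Prop := Relation.ReflTransGen Del

theorem dyckLE_yield_iff {t t' : DyckTree} : dyckLE t'.yield t.yield ↔ t.Reduces t' := by
  constructor
  · suffices ∀ v, dyckLE v t.yield → ∃ t', t'.yield = v ∧ t.Reduces t' by
      intro h
      obtain ⟨u, hu, hr⟩ := this _ h
      rwa [← yield_injective hu]
    intro v h
    induction h with
    | refl => exact ⟨t, rfl, .refl⟩
    | tail _ hstep ih =>
      obtain ⟨u, rfl, hr⟩ := ih
      obtain ⟨u₁, i, j, hu, hm, rfl⟩ := hstep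
      obtain rfl := yield_injective hu
      obtain ⟨t', hd, ht'⟩ := hm.exists_del
      exact ⟨t', ht', hr.tail hd⟩
  · intro h
    refine h.lift yield fun u u' hd => ?_
    obtain ⟨i, j, hm, he⟩ := hd.exists_matches
    exact ⟨u, i, j, rfl, hm, he⟩

theorem Reduces.node {x x' y y' : DyckTree} (hx : x.Reduces x') (hy : y.Reduces y') :
    (DyckTree.node x y).Reduces (.node x' y') :=
  (hx.lift (DyckTree.node · y) fun _ _ => .left y).trans
    (hy.lift (DyckTree.node x') fun _ _ => .right x')

theorem reduces_eps (t : DyckTree) : t.Reduces .eps := by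
  induction t with
  | eps => exact .refl
  | node x y ihx ihy => exact (ihx.node ihy).tail (.head .eps .eps)

theorem node_reduces_left (x y : DyckTree) : (DyckTree.node x y).Reduces x := by
  have h : (DyckTree.node x y).Reduces (.node x .eps) := Reduces.node .refl (reduces_eps y)
  simpa only [append_eps] using h.tail (.head x .eps)

theorem node_reduces_right (x y : DyckTree) : (DyckTree.node x y).Reduces y :=
  (Reduces.node (reduces_eps x) .refl).tail (.head .eps y)

/-- The parse tree of the harmonic `h_q`. -/
def harmonic : ℕ → DyckTree
  | 0 => .eps
  | q + 1 => .node (harmonic q) (.node (harmonic q) .eps)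

theorem yield_harmonic (q : ℕ) : (harmonic q).yield = harmonicW q := by
  induction q with
  | zero => rfl
  | succ q ih => simp [harmonic, harmonicW, yield, ih]

/-- The pair `(r, s)` where `r` is the largest `q` with `h_q ≼ w` and `s` is the number of
`q` with `ā h_q a ≼ w`, computed by recursion on the parse tree of `w`. -/
def ranks : DyckTree → ℕ × ℕ
  | .eps => (0, 0)
  | .node x y =>
    (max (max x.ranks.1 y.ranks.1) (min (x.ranks.1 + 1) y.ranks.2),
      max (x.ranks.1 + 1) y.ranks.2)

theorem ranks_snd_le (t : DyckTree) : t.ranks.2 ≤ t.ranks.1 + 1 := by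
  induction t with
  | eps => simp [ranks]
  | node x y _ ihy => simp only [ranks]; omega

theorem ranks_append (x y : DyckTree) :
    (x.append y).ranks =
      (max (max x.ranks.1 y.ranks.1) (min x.ranks.2 y.ranks.2), max x.ranks.2 y.ranks.2) := by
  induction x with
  | eps => simp [append, ranks]
  | node u v _ ihv =>
    simp only [append, ranks, ihv, Prod.mk.injEq]
    omega

theorem Del.ranks_le {t t' : DyckTree} (h : Del t t') : t'.ranks ≤ t.ranks := by
  rw [Prod.le_def]
  induction h with
  | head x y =>
    have := ranks_snd_le x
    simp only [ranks_append, ranks]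
    omega
  | left y h ih => simp only [ranks]; omega
  | right x h ih => simp only [ranks]; omega

theorem Reduces.ranks_le {t t' : DyckTree} (h : t.Reduces t') : t'.ranks ≤ t.ranks := by
  induction h with
  | refl => exact le_rfl
  | tail _ hd ih => exact hd.ranks_le.trans ih

theorem ranks_harmonic (q : ℕ) : (harmonic q).ranks.1 = q := by
  induction q with
  | zero => rfl
  | succ q ih => simp only [harmonic, ranks, ih]; omega

theorem reduces_harmonic (t : DyckTree) :
    (∀ q ≤ t.ranks.1, t.Reduces (harmonic q)) ∧
      ∀ q < t.ranks.2, t.Reduces (.node (harmonic q) .eps) := by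
  induction t with
  | eps =>
    refine ⟨fun q hq => ?_, fun q hq => absurd hq (Nat.not_lt_zero q)⟩
    obtain rfl : q = 0 := Nat.le_zero.mp hq
    exact .refl
  | node x y ihx ihy =>
    constructor
    · intro q hq
      simp only [ranks, le_max_iff, le_min_iff] at hq
      rcases hq with (hq | hq) | ⟨hx, hy⟩
      · exact (node_reduces_left x y).trans (ihx.1 q hq)
      · exact (node_reduces_right x y).trans (ihy.1 q hq)
      · cases q with
        | zero => exact reduces_eps _
        | succ q => exact (ihx.1 q (by omega)).node (ihy.2 q (by omega))
    · intro q hq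
      simp only [ranks, lt_max_iff] at hq
      rcases hq with hq | hq
      · exact (ihx.1 q (by omega)).node (reduces_eps y)
      · exact (node_reduces_right x y).trans (ihy.2 q hq)

theorem rank_yield (t : DyckTree) : rank t.yield = t.ranks.1 := by
  have h : { q : ℕ | dyckLE (harmonicW q) t.yield } = Set.Iic t.ranks.1 := by
    ext q
    rw [Set.mem_ofPred_eq, ← yield_harmonic, dyckLE_yield_iff, Set.mem_Iic]
    refine ⟨fun hr => ?_, (reduces_harmonic t).1 q⟩
    simpa only [ranks_harmonic] using hr.ranks_le.1
  rw [rank, h, csSup_Iic]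

end DyckTree

namespace CNFTree

variable {N T : Type}

/-- The parse tree of the Dyck word `β` with `α(n) = a β`. -/
def footprint : CNFTree N T → DyckTree
  | .lf _ _ => .node .eps .eps
  | .br _ t₁ t₂ => .node (.node .eps t₁.footprint) t₂.footprint

theorem alphaC_eq (t : CNFTree N T) : alphaC t = D.a :: t.footprint.yield := by
  induction t with
  | lf X b => rfl
  | br X t₁ t₂ ih₁ ih₂ => simp [alphaC, footprint, yield, ih₁, ih₂]

theorem oscC_eq (t : CNFTree N T) : oscC t = (DyckTree.node .eps t.footprint).ranks.1 := by
  rw [← rank_yield, oscC, alphaTC, alphaC_eq]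
  rfl

theorem dimC_bounds (t : CNFTree N T) :
    1 ≤ t.footprint.ranks.2 ∧ max t.footprint.ranks.1 1 ≤ dimC t + 1 ∧
      dimC t + 1 ≤ max t.footprint.ranks.1 1 + t.footprint.ranks.2 := by
  induction t with
  | lf X b => simp [footprint, ranks, dimC]
  | br X t₁ t₂ ih₁ ih₂ =>
    have h₁ := ranks_snd_le t₁.footprint
    have h₂ := ranks_snd_le t₂.footprint
    simp only [footprint, ranks, dimC]
    split_ifs <;> omega

end CNFTree

theorem osc_dim_bounds {N T : Type} (R : Set (N × (N × N ⊕ T))) (S : N)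
    (t : CNFTree N T) (ht : IsCNFTree R t) (hroot : t.root = S) :
    oscC t ≤ dimC t + 1 ∧ dimC t ≤ 2 * oscC t := by
  have h := t.dimC_bounds
  have hs := ranks_snd_le t.footprint
  rw [t.oscC_eq]
  simp only [ranks]
  omega
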